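/- Let SM_{p₁,…,p_k}[F] be a def-module and R a rule in F. Let x be a non-empty tuple of variables occurring in the body of R but not in its head. If G is constructed from F by replacing R with the result of projecting the variables x out of R using a predicate symbol p_{k+1} not in the signature of F, then SM_{p₁,…,p_{k+1}}[G] is a conservative extension of SM_{p₁,…,p_k}[F]. -/

import Mathlib

namespace ASP

/-- A first-order signature: predicate symbols and function symbols with arities.
A function symbol of arity 0 is an object constant. -/
structure Signature where
  PredSym : Type
  FunSym : Type
  predArity : PredSym → ℕ
  funArity : FunSym → ℕ

variable {σ : Signature}

/-- First-order terms over a signature, with variables indexed by natural numbers. -/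
inductive Term (σ : Signature) : Type
  | var : ℕ → Term σ
  | fn : (f : σ.FunSym) → (Fin (σ.funArity f) → Term σ) → Term σ

/-- Function symbols occurring in a term. -/
def Term.funs : Term σ → Set σ.FunSym
  | .var _ => ∅
  | .fn f a => insert f (⋃ i, (a i).funs)

/-- Variables occurring in a term. -/
def Term.fv : Term σ → Set ℕ
  | .var n => {n}
  | .fn _ a => ⋃ i, (a i).fv

/-- First-order formulas (with equality) over a signature. -/
inductive Formula (σ : Signature) : Type
  | falsum
  | pred (p : σ.PredSym) (args : Fin (σ.predArity p) → Term σ)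
  | eq (t u : Term σ)
  | and (F G : Formula σ)
  | or (F G : Formula σ)
  | imp (F G : Formula σ)
  | all (x : ℕ) (F : Formula σ)
  | ex (x : ℕ) (F : Formula σ)

/-- `¬F` abbreviates `F → ⊥`. -/
def Formula.neg (F : Formula σ) : Formula σ := .imp F .falsum

/-- `⊤` abbreviates `⊥ → ⊥`. -/
def Formula.top : Formula σ := .imp .falsum .falsum

/-- Predicate symbols occurring in a formula (equality is not a predicate symbol). -/
def Formula.preds : Formula σ → Set σ.PredSym
  | .falsum => ∅
  | .pred p _ => {p}
  | .eq _ _ => ∅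
  | .and F G => F.preds ∪ G.preds
  | .or F G => F.preds ∪ G.preds
  | .imp F G => F.preds ∪ G.preds
  | .all _ F => F.preds
  | .ex _ F => F.preds

/-- Function symbols occurring in a formula. -/
def Formula.funs : Formula σ → Set σ.FunSym
  | .falsum => ∅
  | .pred _ a => ⋃ i, (a i).funs
  | .eq t u => t.funs ∪ u.funs
  | .and F G => F.funs ∪ G.funs
  | .or F G => F.funs ∪ G.funs
  | .imp F G => F.funs ∪ G.funs
  | .all _ F => F.funs
  | .ex _ F => F.funs

/-- A set of symbols of a signature (a "sub-signature"). -/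
structure SymSet (σ : Signature) where
  preds : Set σ.PredSym
  funs : Set σ.FunSym

instance : Union (SymSet σ) := ⟨fun S T => ⟨S.preds ∪ T.preds, S.funs ∪ T.funs⟩⟩

/-- The signature `σ(F)` of a formula: all function and predicate symbols occurring
in it (equality excluded). -/
def Formula.syms (F : Formula σ) : SymSet σ := ⟨F.preds, F.funs⟩

/-- An interpretation over the symbols in `S`: a nonempty universe, together with
interpretations of the function and predicate symbols; symbols outside `S` are given
fixed default values, so that an interpretation is determined by its values on `S`. -/
structure SInterp (σ : Signature) (S : SymSet σ) where
  U : Type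
  ne : Nonempty U
  funI : (f : σ.FunSym) → (Fin (σ.funArity f) → U) → U
  predI : (p : σ.PredSym) → (Fin (σ.predArity p) → U) → Prop
  fun_default : ∀ f ∉ S.funs, ∀ a, funI f a = Classical.choice ne
  pred_default : ∀ p ∉ S.preds, ∀ a, predI p a = False

open Classical in
/-- The restriction `M|T` of an interpretation to the symbol set `T`. -/
noncomputable def SInterp.restrict {S : SymSet σ} (M : SInterp σ S) (T : SymSet σ) :
    SInterp σ T where
  U := M.U
  ne := M.ne
  funI f a := if f ∈ T.funs then M.funI f a else Classical.choice M.ne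
  predI p a := p ∈ T.preds ∧ M.predI p a
  fun_default := by intro f hf a; simp [hf]
  pred_default := by intro p hp a; simp [hp]

/-- Value of a term in an interpretation under a valuation. -/
def Term.eval {S : SymSet σ} (M : SInterp σ S) (v : ℕ → M.U) : Term σ → M.U
  | .var n => v n
  | .fn f a => M.funI f (fun i => (a i).eval M v)

/-- Tarskian satisfaction of a formula. -/
def Sat {S : SymSet σ} (M : SInterp σ S) (v : ℕ → M.U) : Formula σ → Prop
  | .falsum => False
  | .pred p a => M.predI p (fun i => (a i).eval M v)
  | .eq t u => t.eval M v = u.eval M v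
  | .and F G => Sat M v F ∧ Sat M v G
  | .or F G => Sat M v F ∨ Sat M v G
  | .imp F G => Sat M v F → Sat M v G
  | .all x F => ∀ d, Sat M (Function.update v x d) F
  | .ex x F => ∃ d, Sat M (Function.update v x d) F

/-- An assignment of relations to the predicate symbols (used for the tuple `u`
of predicate variables in the operator SM). -/
def PredAssign (σ : Signature) (U : Type) := (p : σ.PredSym) → (Fin (σ.predArity p) → U) → Prop

/-- Satisfaction of `F^*(u)`, the Ferraris–Lee–Lifschitz transformation of `F`,
where `P` is the set of intensional predicates and `u` interprets the corresponding
predicate variables. -/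
def SatStar {S : SymSet σ} (M : SInterp σ S) (u : PredAssign σ M.U) (P : Set σ.PredSym)
    (v : ℕ → M.U) : Formula σ → Prop
  | .falsum => False
  | .pred p a =>
      (p ∈ P ∧ u p (fun i => (a i).eval M v)) ∨ (p ∉ P ∧ M.predI p (fun i => (a i).eval M v))
  | .eq t s => t.eval M v = s.eval M v
  | .and F G => SatStar M u P v F ∧ SatStar M u P v G
  | .or F G => SatStar M u P v F ∨ SatStar M u P v G
  | .imp F G => (SatStar M u P v F → SatStar M u P v G) ∧ (Sat M v F → Sat M v G)
  | .all x F => ∀ d, SatStar M u P (Function.update v x d) F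
  | .ex x F => ∃ d, SatStar M u P (Function.update v x d) F

/-- `u < p`: the tuple `u` is pointwise contained in the intensional predicates `P`
of `M`, and not conversely. -/
def uLt {S : SymSet σ} (M : SInterp σ S) (P : Set σ.PredSym) (u : PredAssign σ M.U) : Prop :=
  (∀ p ∈ P, ∀ a, u p a → M.predI p a) ∧ ¬(∀ p ∈ P, ∀ a, M.predI p a → u p a)

/-- `M` is a `P`-stable model of the (first-order) formula `F`, i.e. `M` satisfies
`SM_P[F] = F ∧ ¬∃u((u < P) ∧ F^*(u))` (formulas are read as their universal closures,
hence the quantification over valuations). -/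
def Formula.PStable {S : SymSet σ} (P : Set σ.PredSym) (F : Formula σ) (M : SInterp σ S) : Prop :=
  (∀ v, Sat M v F) ∧ ¬∃ u : PredAssign σ M.U, uLt M P u ∧ ∀ v, SatStar M u P v F

/-- An atomic formula headed by a predicate symbol (no equality allowed). -/
def PAtom (σ : Signature) := Σ p : σ.PredSym, Fin (σ.predArity p) → Term σ

/-- An atomic formula: a predicate symbol applied to terms, or an equality. -/
inductive Atom (σ : Signature)
  | pred (p : σ.PredSym) (args : Fin (σ.predArity p) → Term σ)
  | eq (t u : Term σ)

def PAtom.toFormula (a : PAtom σ) : Formula σ := .pred a.1 a.2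

def Atom.toFormula : Atom σ → Formula σ
  | .pred p a => .pred p a
  | .eq t u => .eq t u

/-- A rule `a₁ ; … ; a_k ← a_{k+1}, …, a_l, not a_{l+1}, …, not a_m,
not not a_{m+1}, …, not not a_n`: the head atoms and the doubly negated atoms may
not contain equality. -/
structure Rule (σ : Signature) where
  head : List (PAtom σ)
  pos : List (Atom σ)
  neg : List (Atom σ)
  nneg : List (PAtom σ)

def listAnd (l : List (Formula σ)) : Formula σ := l.foldr .and .top
def listOr (l : List (Formula σ)) : Formula σ := l.foldr .or .falsum

/-- The quantifier-free first-order implication corresponding to a rule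
(its universal closure is taken by all semantic notions below). -/
def Rule.toOpen (R : Rule σ) : Formula σ :=
  .imp (listAnd (R.pos.map Atom.toFormula ++ R.neg.map (fun a => a.toFormula.neg) ++
          R.nneg.map (fun a => a.toFormula.neg.neg)))
       (listOr (R.head.map PAtom.toFormula))

/-- A traditional logic program: a finite set (list) of rules, viewed as the
conjunction of the universal closures of the corresponding implications. -/
abbrev Program (σ : Signature) := List (Rule σ)

/-- `π(Π)`: predicate symbols occurring in a program. -/
def Program.preds (Pg : Program σ) : Set σ.PredSym := {p | ∃ R ∈ Pg, p ∈ R.toOpen.preds}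

/-- Function symbols occurring in a program. -/
def Program.funs (Pg : Program σ) : Set σ.FunSym := {f | ∃ R ∈ Pg, f ∈ R.toOpen.funs}

/-- `σ(Π)`: the signature of a program. -/
def Program.syms (Pg : Program σ) : SymSet σ := ⟨Pg.preds, Pg.funs⟩

/-- `M` is a `P`-stable model of the program `Pg` viewed as a first-order formula
(the conjunction of the universal closures of its rules), i.e. `M ⊨ SM_P[Π]`. -/
def Program.PStable {S : SymSet σ} (P : Set σ.PredSym) (Pg : Program σ) (M : SInterp σ S) : Prop :=
  (∀ R ∈ Pg, ∀ v, Sat M v R.toOpen) ∧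
  ¬∃ u : PredAssign σ M.U, uLt M P u ∧ ∀ R ∈ Pg, ∀ v, SatStar M u P v R.toOpen


/-- A class of models `MBig` (over symbols `SG`) is a *conservative extension* of a
class of models `MSmall` (over symbols `SF`) if `M ↦ M|SF` is a 1-1 correspondence
between `MBig` and `MSmall`. -/
def ConsExt {SG SF : SymSet σ} (MBig : Set (SInterp σ SG)) (MSmall : Set (SInterp σ SF)) :
    Prop :=
  (∀ M ∈ MBig, M.restrict SF ∈ MSmall) ∧
  ∀ N ∈ MSmall, ∃! M : SInterp σ SG, M ∈ MBig ∧ M.restrict SF = N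

/-- Variables occurring in an atomic formula without equality. -/
def PAtom.fv (a : PAtom σ) : Set ℕ := ⋃ i, (a.2 i).fv

/-- Variables occurring in an atomic formula. -/
def Atom.fv : Atom σ → Set ℕ
  | .pred _ a => ⋃ i, (a i).fv
  | .eq t u => t.fv ∪ u.fv

/-- Variables occurring in the head of a rule. -/
def Rule.headVars (R : Rule σ) : Set ℕ := {v | ∃ a ∈ R.head, v ∈ a.fv}

/-- Variables occurring in the body of a rule. -/
def Rule.bodyVars (R : Rule σ) : Set ℕ :=
  {v | (∃ a ∈ R.pos, v ∈ a.fv) ∨ (∃ a ∈ R.neg, v ∈ a.fv) ∨ (∃ a ∈ R.nneg, v ∈ a.fv)}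

/-- The variables `y`: all variables occurring in the conjunctive terms of the body
of `R` that contain at least one variable from `xs` (the part `α(x,y)`), but not
occurring in `xs`. -/
def Rule.alphaVars (R : Rule σ) (xs : Set ℕ) : Set ℕ :=
  {v | v ∉ xs ∧
    ((∃ a ∈ R.pos, v ∈ a.fv ∧ (a.fv ∩ xs).Nonempty) ∨
     (∃ a ∈ R.neg, v ∈ a.fv ∧ (a.fv ∩ xs).Nonempty) ∨
     (∃ a ∈ R.nneg, v ∈ a.fv ∧ (a.fv ∩ xs).Nonempty))}

open Classical in
/-- The result of projecting the variables `xs` out of the rule `R` using the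
predicate symbol `t` (whose argument tuple is the list `ys` of variables): the pair
of rules `∀̃((t(y) ∧ β) → γ)` and `∀ x y (α(x,y) → t(y))`, where `α(x,y)` is the
conjunction of the conjunctive terms of the body of `R` containing at least one
variable from `xs`, `β` the conjunction of the remaining conjunctive terms of the
body, and `γ` the head of `R`. -/
noncomputable def Rule.project (R : Rule σ) (xs : Set ℕ) (t : σ.PredSym) (ys : List ℕ)
    (har : σ.predArity t = ys.length) : Rule σ × Rule σ :=
  let targs : Fin (σ.predArity t) → Term σ := fun i => Term.var (ys.get (Fin.cast har i))
  ( { head := R.head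
    , pos := Atom.pred t targs :: R.pos.filter (fun a => decide ¬(a.fv ∩ xs).Nonempty)
    , neg := R.neg.filter (fun a => decide ¬(a.fv ∩ xs).Nonempty)
    , nneg := R.nneg.filter (fun a => decide ¬(a.fv ∩ xs).Nonempty) }
  , { head := [⟨t, targs⟩]
    , pos := R.pos.filter (fun a => decide (a.fv ∩ xs).Nonempty)
    , neg := R.neg.filter (fun a => decide (a.fv ∩ xs).Nonempty)
    , nneg := R.nneg.filter (fun a => decide (a.fv ∩ xs).Nonempty) } )

/-- Free variables of a formula. -/
def Formula.fv : Formula σ → Set ℕ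
  | .falsum => ∅
  | .pred _ a => ⋃ i, (a i).fv
  | .eq t u => t.fv ∪ u.fv
  | .and F G => F.fv ∪ G.fv
  | .or F G => F.fv ∪ G.fv
  | .imp F G => F.fv ∪ G.fv
  | .all x F => F.fv \ {x}
  | .ex x F => F.fv \ {x}

theorem Term.eval_congr {S : SymSet σ} (M : SInterp σ S) {v w : ℕ → M.U} (s : Term σ)
    (h : ∀ x ∈ s.fv, v x = w x) : s.eval M v = s.eval M w := by
  induction s with
  | var n => exact h n rfl
  | fn f a ih =>
    simp only [Term.eval]
    congr 1
    funext i
    exact ih i fun x hx => h x (Set.mem_iUnion.2 ⟨i, hx⟩)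

theorem update_eq_on_fv {U : Type} {v w : ℕ → U} {V : Set ℕ} {x : ℕ} (d : U)
    (h : ∀ y ∈ V \ {x}, v y = w y) :
    ∀ y ∈ V, Function.update v x d y = Function.update w x d y := by
  intro y hy
  by_cases hyx : y = x
  · subst hyx; simp
  · simp [hyx, h y ⟨hy, hyx⟩]

theorem sat_congr {S : SymSet σ} (M : SInterp σ S) (F : Formula σ) {v w : ℕ → M.U}
    (h : ∀ x ∈ F.fv, v x = w x) : Sat M v F ↔ Sat M w F := by
  induction F generalizing v w with
  | falsum => rfl
  | pred p a =>
    have : (fun i => (a i).eval M v) = fun i => (a i).eval M w := funext fun i =>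
      Term.eval_congr M _ fun x hx => h x (Set.mem_iUnion.2 ⟨i, hx⟩)
    simp only [Sat, this]
  | eq s r =>
    simp only [Sat, Term.eval_congr M s fun x hx => h x (Or.inl hx),
      Term.eval_congr M r fun x hx => h x (Or.inr hx)]
  | and F G ihF ihG | or F G ihF ihG | imp F G ihF ihG =>
    simp only [Sat, ihF fun x hx => h x (Or.inl hx), ihG fun x hx => h x (Or.inr hx)]
  | all x F ih => exact forall_congr' fun d => ih (update_eq_on_fv d h)
  | ex x F ih => exact exists_congr fun d => ih (update_eq_on_fv d h)

theorem satStar_congr {S : SymSet σ} (M : SInterp σ S) (u : PredAssign σ M.U)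
    (P : Set σ.PredSym) (F : Formula σ) {v w : ℕ → M.U} (h : ∀ x ∈ F.fv, v x = w x) :
    SatStar M u P v F ↔ SatStar M u P w F := by
  induction F generalizing v w with
  | falsum => rfl
  | pred p a =>
    have : (fun i => (a i).eval M v) = fun i => (a i).eval M w := funext fun i =>
      Term.eval_congr M _ fun x hx => h x (Set.mem_iUnion.2 ⟨i, hx⟩)
    simp only [SatStar, this]
  | eq s r =>
    simp only [SatStar, Term.eval_congr M s fun x hx => h x (Or.inl hx),
      Term.eval_congr M r fun x hx => h x (Or.inr hx)]
  | and F G ihF ihG | or F G ihF ihG =>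
    simp only [SatStar, ihF fun x hx => h x (Or.inl hx), ihG fun x hx => h x (Or.inr hx)]
  | imp F G ihF ihG =>
    have hF : ∀ x ∈ F.fv, v x = w x := fun x hx => h x (Or.inl hx)
    have hG : ∀ x ∈ G.fv, v x = w x := fun x hx => h x (Or.inr hx)
    simp only [SatStar, ihF hF, ihG hG, sat_congr M F hF, sat_congr M G hG]
  | all x F ih => exact forall_congr' fun d => ih (update_eq_on_fv d h)
  | ex x F ih => exact exists_congr fun d => ih (update_eq_on_fv d h)

/-- All symbols of the formula belong to the given symbol set. -/
def Formula.Over (F : Formula σ) (T : SymSet σ) : Prop :=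
  F.preds ⊆ T.preds ∧ F.funs ⊆ T.funs

theorem Term.eval_restrict {S : SymSet σ} (M : SInterp σ S) (T : SymSet σ) (v : ℕ → M.U)
    (s : Term σ) (h : s.funs ⊆ T.funs) : s.eval (M.restrict T) v = s.eval M v := by
  induction s with
  | var n => rfl
  | fn f a ih =>
    have hf : f ∈ T.funs := h (Set.mem_insert _ _)
    have ha : (fun i => (a i).eval (M.restrict T) v) = fun i => (a i).eval M v :=
      funext fun i => ih i fun g hg =>
        h (Set.mem_insert_of_mem _ (Set.mem_iUnion.2 ⟨i, hg⟩))
    simp only [Term.eval]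
    rw [ha]
    simp [SInterp.restrict, hf]

theorem sat_restrict {S : SymSet σ} (M : SInterp σ S) {T : SymSet σ} {F : Formula σ}
    (h : F.Over T) (v : ℕ → M.U) : Sat (M.restrict T) v F ↔ Sat M v F := by
  obtain ⟨hp, hf⟩ := h
  induction F generalizing v with
  | falsum => rfl
  | pred p a =>
    have ha : (fun i => (a i).eval (M.restrict T) v) = fun i => (a i).eval M v :=
      funext fun i => Term.eval_restrict M T v _ fun g hg => hf (Set.mem_iUnion.2 ⟨i, hg⟩)
    have hpT : p ∈ T.preds := hp rfl
    simp only [Sat]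
    rw [ha]
    simp [SInterp.restrict, hpT]
  | eq s r =>
    simp only [Sat]
    rw [Term.eval_restrict M T v s fun g hg => hf (Or.inl hg),
      Term.eval_restrict M T v r fun g hg => hf (Or.inr hg)]
    rfl
  | and F G ihF ihG | or F G ihF ihG | imp F G ihF ihG =>
    simp only [Sat, ihF v (fun x hx => hp (Or.inl hx)) (fun x hx => hf (Or.inl hx)),
      ihG v (fun x hx => hp (Or.inr hx)) (fun x hx => hf (Or.inr hx))]
  | all x F ih => exact forall_congr' fun d => ih _ hp hf
  | ex x F ih => exact exists_congr fun d => ih _ hp hf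

theorem satStar_restrict {S : SymSet σ} (M : SInterp σ S) {T : SymSet σ} {F : Formula σ}
    (h : F.Over T) {u u' : PredAssign σ M.U} {P P' : Set σ.PredSym}
    (hP : ∀ p ∈ F.preds, (p ∈ P ↔ p ∈ P')) (hu : ∀ p ∈ F.preds, u p = u' p) (v : ℕ → M.U) :
    SatStar (M.restrict T) u P v F ↔ SatStar M u' P' v F := by
  obtain ⟨hp, hf⟩ := h
  induction F generalizing v with
  | falsum => rfl
  | pred p a =>
    have ha : (fun i => (a i).eval (M.restrict T) v) = fun i => (a i).eval M v :=
      funext fun i => Term.eval_restrict M T v _ fun g hg => hf (Set.mem_iUnion.2 ⟨i, hg⟩)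
    have hpT : p ∈ T.preds := hp rfl
    simp only [SatStar]
    rw [ha, hu p rfl, hP p rfl]
    simp [SInterp.restrict, hpT]
  | eq s r =>
    simp only [SatStar]
    rw [Term.eval_restrict M T v s fun g hg => hf (Or.inl hg),
      Term.eval_restrict M T v r fun g hg => hf (Or.inr hg)]
    rfl
  | and F G ihF ihG | or F G ihF ihG =>
    simp only [SatStar,
      ihF (fun p h => hP p (Or.inl h)) (fun p h => hu p (Or.inl h)) v
        (fun x hx => hp (Or.inl hx)) (fun x hx => hf (Or.inl hx)),
      ihG (fun p h => hP p (Or.inr h)) (fun p h => hu p (Or.inr h)) v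
        (fun x hx => hp (Or.inr hx)) (fun x hx => hf (Or.inr hx))]
  | imp F G ihF ihG =>
    have hF : F.Over T := ⟨fun x hx => hp (Or.inl hx), fun x hx => hf (Or.inl hx)⟩
    have hG : G.Over T := ⟨fun x hx => hp (Or.inr hx), fun x hx => hf (Or.inr hx)⟩
    simp only [SatStar, sat_restrict M hF, sat_restrict M hG,
      ihF (fun p h => hP p (Or.inl h)) (fun p h => hu p (Or.inl h)) v hF.1 hF.2,
      ihG (fun p h => hP p (Or.inr h)) (fun p h => hu p (Or.inr h)) v hG.1 hG.2]
  | all x F ih => exact forall_congr' fun d => ih hP hu _ hp hf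
  | ex x F ih => exact exists_congr fun d => ih hP hu _ hp hf

theorem satStar_iff_sat {S : SymSet σ} (M : SInterp σ S) {u : PredAssign σ M.U}
    {P : Set σ.PredSym} {F : Formula σ} (hu : ∀ p ∈ F.preds, p ∈ P → u p = M.predI p)
    (v : ℕ → M.U) : SatStar M u P v F ↔ Sat M v F := by
  induction F generalizing v with
  | falsum => rfl
  | pred p a =>
    by_cases hp : p ∈ P
    · simp [SatStar, Sat, hp, hu p rfl hp]
    · simp [SatStar, Sat, hp]
  | eq s r => rfl
  | and F G ihF ihG | or F G ihF ihG | imp F G ihF ihG =>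
    simp [SatStar, Sat, ihF fun p h => hu p (Or.inl h), ihG fun p h => hu p (Or.inr h)]
  | all x F ih => exact forall_congr' fun d => ih hu _
  | ex x F ih => exact exists_congr fun d => ih hu _

theorem SatStar.sat {S : SymSet σ} {M : SInterp σ S} {u : PredAssign σ M.U}
    {P : Set σ.PredSym} {F : Formula σ} (hu : ∀ p ∈ F.preds, p ∈ P → ∀ a, u p a → M.predI p a)
    {v : ℕ → M.U} (h : SatStar M u P v F) : Sat M v F := by
  induction F generalizing v with
  | falsum => exact h
  | pred p a => exact h.elim (fun h => hu p rfl h.1 _ h.2) (fun h => h.2)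
  | eq s r => exact h
  | and F G ihF ihG =>
    exact ⟨ihF (fun p h => hu p (Or.inl h)) h.1, ihG (fun p h => hu p (Or.inr h)) h.2⟩
  | or F G ihF ihG =>
    exact h.imp (ihF fun p h => hu p (Or.inl h)) (ihG fun p h => hu p (Or.inr h))
  | imp F G ihF ihG => exact h.2
  | all x F ih => exact fun d => ih hu (h d)
  | ex x F ih => exact h.imp fun d => ih hu

open Classical in
/-- The relation assignment that agrees with `u` except that `t` is sent to `T`. -/
noncomputable def PredAssign.set {U : Type} (u : PredAssign σ U) (t : σ.PredSym)
    (T : (Fin (σ.predArity t) → U) → Prop) : PredAssign σ U :=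
  fun p => if h : p = t then fun a => T (h ▸ a) else u p

theorem PredAssign.set_self {U : Type} (u : PredAssign σ U) (t : σ.PredSym)
    (T : (Fin (σ.predArity t) → U) → Prop) : u.set t T t = T := by
  simp [PredAssign.set]

theorem PredAssign.set_of_ne {U : Type} (u : PredAssign σ U) {t p : σ.PredSym}
    (T : (Fin (σ.predArity t) → U) → Prop) (h : p ≠ t) : u.set t T p = u p := by
  simp [PredAssign.set, h]

/-- Extend an interpretation to a larger symbol set, interpreting `t` by `T`. -/
noncomputable def SInterp.extend {S S' : SymSet σ} (N : SInterp σ S)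
    (hf : S.funs ⊆ S'.funs) (hp : S.preds ⊆ S'.preds) (t : σ.PredSym) (ht : t ∈ S'.preds)
    (T : (Fin (σ.predArity t) → N.U) → Prop) : SInterp σ S' where
  U := N.U
  ne := N.ne
  funI := N.funI
  predI := PredAssign.set N.predI t T
  fun_default f h a := N.fun_default f (fun h' => h (hf h')) a
  pred_default p h a := by
    have hpt : p ≠ t := fun e => h (e ▸ ht)
    exact (congrFun (PredAssign.set_of_ne N.predI T hpt) a).trans
      (N.pred_default p (fun h' => h (hp h')) a)

theorem SInterp.mk_congr {S : SymSet σ} {U : Type} {ne : Nonempty U}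
    {f f' : (f : σ.FunSym) → (Fin (σ.funArity f) → U) → U} {p p' : PredAssign σ U}
    {hf hf' hp hp'} (h : f = f') (h' : p = p') :
    SInterp.mk (S := S) U ne f p hf hp = SInterp.mk U ne f' p' hf' hp' := by
  subst h h'; rfl

theorem sat_of_eq {S : SymSet σ} {N N' : SInterp σ S} (e : N' = N) (hU : N.U = N'.U)
    (v : ℕ → N.U) (F : Formula σ) : Sat N' (fun i => cast hU (v i)) F ↔ Sat N v F := by
  subst e; rfl

open Classical in
theorem SInterp.extend_restrict {S S' : SymSet σ} (N : SInterp σ S)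
    (hf : S.funs ⊆ S'.funs) (hp : S.preds ⊆ S'.preds) (t : σ.PredSym) (ht : t ∈ S'.preds)
    (htS : t ∉ S.preds) (T : (Fin (σ.predArity t) → N.U) → Prop) :
    (N.extend hf hp t ht T).restrict S = N := by
  obtain ⟨U, ne, fI, pI, hfd, hpd⟩ := N
  apply SInterp.mk_congr
  · funext f (a : _ → U)
    change (if f ∈ S.funs then fI f a else Classical.choice ne) = fI f a
    split_ifs with h
    · rfl
    · exact (hfd f h a).symm
  · funext p (a : _ → U)
    change (p ∈ S.preds ∧ PredAssign.set pI t T p a) = pI p a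
    by_cases h : p ∈ S.preds
    · have hpt : p ≠ t := fun e => htS (e ▸ h)
      have := congrFun (PredAssign.set_of_ne pI T hpt) a
      exact (and_iff_right h).eq.trans this
    · simp [h, hpd p h a]

open Classical in
theorem SInterp.restrict_extend {S S' : SymSet σ} (M : SInterp σ S')
    (hf : S.funs ⊆ S'.funs) (hp : S.preds ⊆ S'.preds) (t : σ.PredSym) (ht : t ∈ S'.preds)
    (hf' : S'.funs ⊆ S.funs) (hp' : S'.preds ⊆ insert t S.preds)
    (T : (Fin (σ.predArity t) → M.U) → Prop) (hT : M.predI t = T) :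
    (M.restrict S).extend hf hp t ht T = M := by
  obtain ⟨U, ne, fI, pI, hfd, hpd⟩ := M
  apply SInterp.mk_congr
  · funext f (a : _ → U)
    change (if f ∈ S.funs then fI f a else Classical.choice ne) = fI f a
    split_ifs with h
    · rfl
    · exact (hfd f (fun h' => h (hf' h')) a).symm
  · funext p (a : _ → U)
    let r : PredAssign σ U := fun p a => p ∈ S.preds ∧ pI p a
    change r.set t T p a = pI p a
    by_cases h : p = t
    · subst h
      exact congrFun ((r.set_self p T).trans hT.symm) a
    · rw [r.set_of_ne T h]
      change (p ∈ S.preds ∧ pI p a) = pI p a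
      by_cases hpS : p ∈ S.preds
      · simp [hpS]
      · have : p ∉ S'.preds := fun h' => (hp' h').elim h hpS
        simp [hpS, hpd p this a]

/-- The conjunctive terms of the body of a rule. -/
def Rule.body (R : Rule σ) : List (Formula σ) :=
  R.pos.map Atom.toFormula ++ R.neg.map (fun a => a.toFormula.neg) ++
    R.nneg.map (fun a => a.toFormula.neg.neg)

/-- The head of a rule, as a formula. -/
def Rule.headFormula (R : Rule σ) : Formula σ := listOr (R.head.map PAtom.toFormula)

theorem sat_listAnd {S : SymSet σ} (M : SInterp σ S) (v : ℕ → M.U) (l : List (Formula σ)) :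
    Sat M v (listAnd l) ↔ ∀ F ∈ l, Sat M v F := by
  induction l with
  | nil => simp [listAnd, Formula.top, Sat]
  | cons F l ih => simpa [listAnd, Sat] using fun _ => ih

theorem satStar_listAnd {S : SymSet σ} (M : SInterp σ S) (u : PredAssign σ M.U)
    (P : Set σ.PredSym) (v : ℕ → M.U) (l : List (Formula σ)) :
    SatStar M u P v (listAnd l) ↔ ∀ F ∈ l, SatStar M u P v F := by
  induction l with
  | nil => simp [listAnd, Formula.top, Sat, SatStar]
  | cons F l ih => simpa [listAnd, SatStar] using fun _ => ih

theorem sat_toOpen {S : SymSet σ} (M : SInterp σ S) (v : ℕ → M.U) (R : Rule σ) :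
    Sat M v R.toOpen ↔ ((∀ F ∈ R.body, Sat M v F) → Sat M v R.headFormula) := by
  rw [← sat_listAnd]; rfl

theorem satStar_toOpen {S : SymSet σ} (M : SInterp σ S) (u : PredAssign σ M.U)
    (P : Set σ.PredSym) (v : ℕ → M.U) (R : Rule σ) :
    SatStar M u P v R.toOpen ↔
      ((∀ F ∈ R.body, SatStar M u P v F) → SatStar M u P v R.headFormula) ∧
        Sat M v R.toOpen := by
  rw [← satStar_listAnd]; rfl

theorem preds_listAnd (l : List (Formula σ)) : (listAnd l).preds = {p | ∃ F ∈ l, p ∈ F.preds} := by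
  induction l with
  | nil => simp [listAnd, Formula.top, Formula.preds]
  | cons F l ih =>
    change F.preds ∪ (listAnd l).preds = _
    rw [ih]; ext p; simp

theorem funs_listAnd (l : List (Formula σ)) : (listAnd l).funs = {p | ∃ F ∈ l, p ∈ F.funs} := by
  induction l with
  | nil => simp [listAnd, Formula.top, Formula.funs]
  | cons F l ih =>
    change F.funs ∪ (listAnd l).funs = _
    rw [ih]; ext p; simp

theorem mem_preds_toOpen (R : Rule σ) (p : σ.PredSym) :
    p ∈ R.toOpen.preds ↔ (∃ F ∈ R.body, p ∈ F.preds) ∨ p ∈ R.headFormula.preds := by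
  change p ∈ (listAnd R.body).preds ∪ R.headFormula.preds ↔ _
  rw [preds_listAnd]; rfl

theorem mem_funs_toOpen (R : Rule σ) (f : σ.FunSym) :
    f ∈ R.toOpen.funs ↔ (∃ F ∈ R.body, f ∈ F.funs) ∨ f ∈ R.headFormula.funs := by
  change f ∈ (listAnd R.body).funs ∪ R.headFormula.funs ↔ _
  rw [funs_listAnd]; rfl

theorem fv_listOr (l : List (Formula σ)) : (listOr l).fv = {x | ∃ F ∈ l, x ∈ F.fv} := by
  induction l with
  | nil => simp [listOr, Formula.fv]
  | cons F l ih =>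
    change F.fv ∪ (listOr l).fv = _
    rw [ih]; ext p; simp

theorem fv_headFormula (R : Rule σ) : R.headFormula.fv = R.headVars := by
  rw [Rule.headFormula, fv_listOr]
  ext x
  simp [Rule.headVars, PAtom.toFormula, PAtom.fv, Formula.fv]

theorem Atom.fv_toFormula (a : Atom σ) : a.toFormula.fv = a.fv := by
  cases a <;> rfl

theorem PAtom.fv_toFormula (a : PAtom σ) : a.toFormula.fv = a.fv := rfl

theorem Formula.fv_neg (F : Formula σ) : F.neg.fv = F.fv := by
  simp [Formula.neg, Formula.fv]

section Projection

variable (R : Rule σ) (xs : Set ℕ) (t : σ.PredSym) (ys : List ℕ)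
  (har : σ.predArity t = ys.length)

/-- The atom `t(y)` introduced by projection. -/
def projAtom : Formula σ := .pred t fun i => Term.var (ys.get (Fin.cast har i))

open Classical in
/-- The conjunctive terms `β` of the body that contain no variable from `xs`. -/
noncomputable def Rule.betaBody : List (Formula σ) :=
  R.body.filter fun F => decide ¬(F.fv ∩ xs).Nonempty

theorem mem_body_project_fst (F : Formula σ) :
    F ∈ (R.project xs t ys har).1.body ↔ F = projAtom t ys har ∨ F ∈ R.betaBody xs := by
  simp only [Rule.project, Rule.body, Rule.betaBody, List.map_cons, List.cons_append,
    List.mem_cons, List.mem_append, List.mem_map, List.mem_filter, decide_eq_true_eq]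
  apply or_congr Iff.rfl
  constructor
  · rintro ((⟨a, ⟨h, h'⟩, rfl⟩ | ⟨a, ⟨h, h'⟩, rfl⟩) | ⟨a, ⟨h, h'⟩, rfl⟩)
    · exact ⟨.inl (.inl ⟨a, h, rfl⟩), by rwa [Atom.fv_toFormula]⟩
    · exact ⟨.inl (.inr ⟨a, h, rfl⟩), by rwa [Formula.fv_neg, Atom.fv_toFormula]⟩
    · exact ⟨.inr ⟨a, h, rfl⟩, by rwa [Formula.fv_neg, Formula.fv_neg, PAtom.fv_toFormula]⟩
  · rintro ⟨(⟨a, h, rfl⟩ | ⟨a, h, rfl⟩) | ⟨a, h, rfl⟩, h'⟩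
    · exact .inl (.inl ⟨a, ⟨h, by rwa [Atom.fv_toFormula] at h'⟩, rfl⟩)
    · exact .inl (.inr ⟨a, ⟨h, by rwa [Formula.fv_neg, Atom.fv_toFormula] at h'⟩, rfl⟩)
    · exact .inr ⟨a, ⟨h, by
        rwa [Formula.fv_neg, Formula.fv_neg, PAtom.fv_toFormula] at h'⟩, rfl⟩

open Classical in
/-- The conjunctive terms `α` of the body that contain a variable from `xs`. -/
noncomputable def Rule.alphaBody : List (Formula σ) :=
  R.body.filter fun F => decide (F.fv ∩ xs).Nonempty

theorem mem_body_project_snd (F : Formula σ) :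
    F ∈ (R.project xs t ys har).2.body ↔ F ∈ R.alphaBody xs := by
  simp only [Rule.project, Rule.body, Rule.alphaBody,
    List.mem_append, List.mem_map, List.mem_filter, decide_eq_true_eq]
  constructor
  · rintro ((⟨a, ⟨h, h'⟩, rfl⟩ | ⟨a, ⟨h, h'⟩, rfl⟩) | ⟨a, ⟨h, h'⟩, rfl⟩)
    · exact ⟨.inl (.inl ⟨a, h, rfl⟩), by rwa [Atom.fv_toFormula]⟩
    · exact ⟨.inl (.inr ⟨a, h, rfl⟩), by rwa [Formula.fv_neg, Atom.fv_toFormula]⟩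
    · exact ⟨.inr ⟨a, h, rfl⟩, by rwa [Formula.fv_neg, Formula.fv_neg, PAtom.fv_toFormula]⟩
  · rintro ⟨(⟨a, h, rfl⟩ | ⟨a, h, rfl⟩) | ⟨a, h, rfl⟩, h'⟩
    · exact .inl (.inl ⟨a, ⟨h, by rwa [Atom.fv_toFormula] at h'⟩, rfl⟩)
    · exact .inl (.inr ⟨a, ⟨h, by rwa [Formula.fv_neg, Atom.fv_toFormula] at h'⟩, rfl⟩)
    · exact .inr ⟨a, ⟨h, by
        rwa [Formula.fv_neg, Formula.fv_neg, PAtom.fv_toFormula] at h'⟩, rfl⟩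

theorem mem_body_iff (F : Formula σ) :
    F ∈ R.body ↔ F ∈ R.alphaBody xs ∨ F ∈ R.betaBody xs := by
  simp only [Rule.alphaBody, Rule.betaBody, List.mem_filter, decide_eq_true_eq]
  tauto

theorem fv_alphaBody {F : Formula σ} (hF : F ∈ R.alphaBody xs) {x : ℕ} (hx : x ∈ F.fv)
    (hxs : x ∉ xs) : x ∈ R.alphaVars xs := by
  simp only [Rule.alphaBody, Rule.body, List.mem_append, List.mem_map, List.mem_filter,
    decide_eq_true_eq] at hF
  refine ⟨hxs, ?_⟩
  obtain ⟨(⟨a, h, rfl⟩ | ⟨a, h, rfl⟩) | ⟨a, h, rfl⟩, h'⟩ := hF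
  · rw [Atom.fv_toFormula] at h' hx
    exact .inl ⟨a, h, hx, h'⟩
  · rw [Formula.fv_neg, Atom.fv_toFormula] at h' hx
    exact .inr (.inl ⟨a, h, hx, h'⟩)
  · rw [Formula.fv_neg, Formula.fv_neg, PAtom.fv_toFormula] at h' hx
    exact .inr (.inr ⟨a, h, hx, h'⟩)

theorem notMem_fv_betaBody {F : Formula σ} (hF : F ∈ R.betaBody xs) {x : ℕ} (hx : x ∈ F.fv) :
    x ∉ xs := by
  simp only [Rule.betaBody, List.mem_filter, decide_eq_true_eq] at hF
  exact fun h => hF.2 ⟨x, hx, h⟩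

/-- The relation `∃ x α(x, y)`, for a notion of satisfaction `Φ`. -/
def projRel {U : Type} (Φ : (ℕ → U) → Formula σ → Prop) (a : Fin (σ.predArity t) → U) : Prop :=
  ∃ v : ℕ → U, (fun i => v (ys.get (Fin.cast har i))) = a ∧ ∀ F ∈ R.alphaBody xs, Φ v F

theorem forall_body_imp_head_iff {U : Type} {Φ : (ℕ → U) → Formula σ → Prop}
    (hΦ : ∀ F v w, (∀ x ∈ F.fv, v x = w x) → (Φ v F ↔ Φ w F))
    (hxh : xs ∩ R.headVars = ∅) (hys : {v | v ∈ ys} = R.alphaVars xs) :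
    (∀ v, (∀ F ∈ R.body, Φ v F) → Φ v R.headFormula) ↔
      ∀ v, projRel R xs t ys har Φ (fun i => v (ys.get (Fin.cast har i))) →
        (∀ F ∈ R.betaBody xs, Φ v F) → Φ v R.headFormula := by
  classical
  constructor
  · rintro h v ⟨w, hw, hα⟩ hβ
    let z : ℕ → U := fun x => if x ∈ xs then w x else v x
    have hzv : ∀ x, x ∉ xs → v x = z x := fun x hx => by simp [z, hx]
    have hzw : ∀ x, x ∈ xs ∨ x ∈ ys → w x = z x := by
      intro x hx
      by_cases hxs : x ∈ xs
      · simp [z, hxs]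
      · obtain ⟨i, rfl⟩ := List.mem_iff_get.1 (hx.resolve_left hxs)
        have := congrFun hw (Fin.cast har.symm i)
        have h : w (ys.get i) = v (ys.get i) := this
        rw [h, hzv _ hxs]
    rw [hΦ _ v z fun x hx => hzv x fun hxs => by
      rw [fv_headFormula] at hx
      exact (Set.eq_empty_iff_forall_notMem.1 hxh) x ⟨hxs, hx⟩]
    refine h z fun F hF => ?_
    rcases (mem_body_iff R xs F).1 hF with hF | hF
    · refine (hΦ F w z fun x hx => hzw x ?_).1 (hα F hF)
      by_cases hxs : x ∈ xs
      · exact .inl hxs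
      · have := fv_alphaBody R xs hF hx hxs
        rw [← hys] at this
        exact .inr this
    · exact (hΦ F v z fun x hx => hzv x (notMem_fv_betaBody R xs hF hx)).1 (hβ F hF)
  · intro h v hv
    exact h v ⟨v, rfl, fun F hF => hv F ((mem_body_iff R xs F).2 (.inl hF))⟩
      fun F hF => hv F ((mem_body_iff R xs F).2 (.inr hF))

theorem headFormula_project_snd :
    (R.project xs t ys har).2.headFormula = .or (projAtom t ys har) .falsum := rfl

variable {S : SymSet σ} (M : SInterp σ S)

theorem sat_project_fst (v : ℕ → M.U) :
    Sat M v (R.project xs t ys har).1.toOpen ↔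
      (M.predI t (fun i => v (ys.get (Fin.cast har i))) →
        (∀ F ∈ R.betaBody xs, Sat M v F) → Sat M v R.headFormula) := by
  rw [sat_toOpen]
  simp only [mem_body_project_fst, forall_eq_or_imp, and_imp]
  rfl

theorem sat_project_snd (v : ℕ → M.U) :
    Sat M v (R.project xs t ys har).2.toOpen ↔
      ((∀ F ∈ R.alphaBody xs, Sat M v F) →
        M.predI t (fun i => v (ys.get (Fin.cast har i)))) := by
  rw [sat_toOpen]
  simp only [mem_body_project_snd]
  exact imp_congr Iff.rfl (iff_of_eq (or_false _))

theorem satStar_project_fst (u : PredAssign σ M.U) {P : Set σ.PredSym} (ht : t ∈ P)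
    (v : ℕ → M.U) :
    SatStar M u P v (R.project xs t ys har).1.toOpen ↔
      (u t (fun i => v (ys.get (Fin.cast har i))) →
        (∀ F ∈ R.betaBody xs, SatStar M u P v F) → SatStar M u P v R.headFormula) ∧
      Sat M v (R.project xs t ys har).1.toOpen := by
  rw [satStar_toOpen]
  simp only [mem_body_project_fst, forall_eq_or_imp, and_imp]
  have : SatStar M u P v (projAtom t ys har) ↔ u t (fun i => v (ys.get (Fin.cast har i))) := by
    simp [SatStar, projAtom, ht, Term.eval]
  rw [this]
  rfl

theorem satStar_project_snd (u : PredAssign σ M.U) {P : Set σ.PredSym} (ht : t ∈ P)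
    (v : ℕ → M.U) :
    SatStar M u P v (R.project xs t ys har).2.toOpen ↔
      ((∀ F ∈ R.alphaBody xs, SatStar M u P v F) →
        u t (fun i => v (ys.get (Fin.cast har i)))) ∧
      Sat M v (R.project xs t ys har).2.toOpen := by
  rw [satStar_toOpen]
  simp only [mem_body_project_snd]
  have : SatStar M u P v (R.project xs t ys har).2.headFormula ↔
      u t (fun i => v (ys.get (Fin.cast har i))) := by
    rw [headFormula_project_snd]
    simp [SatStar, projAtom, ht, Term.eval]
  rw [this]

theorem forall_sat_project_snd :
    (∀ v, Sat M v (R.project xs t ys har).2.toOpen) ↔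
      ∀ a, projRel R xs t ys har (Sat M) a → M.predI t a := by
  simp only [sat_project_snd, projRel]
  constructor
  · rintro h a ⟨v, rfl, hv⟩
    exact h v hv
  · exact fun h v hv => h _ ⟨v, rfl, hv⟩

variable (F1 F2 : Program σ)

/-- The program in which the rule is replaced by its projection. -/
noncomputable def projProgram : Program σ :=
  F1 ++ [(Rule.project R xs t ys har).1, (Rule.project R xs t ys har).2] ++ F2

theorem forall_mem_projProgram {p : Rule σ → Prop} :
    (∀ Q ∈ projProgram R xs t ys har F1 F2, p Q) ↔
      (∀ Q ∈ F1 ++ F2, p Q) ∧ p (R.project xs t ys har).1 ∧ p (R.project xs t ys har).2 := by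
  simp only [projProgram, List.mem_append, List.mem_cons, List.not_mem_nil]
  grind

theorem forall_mem_program {p : Rule σ → Prop} :
    (∀ Q ∈ F1 ++ R :: F2, p Q) ↔ (∀ Q ∈ F1 ++ F2, p Q) ∧ p R := by
  simp only [List.mem_append, List.mem_cons]
  grind

theorem mem_preds_projProgram (p : σ.PredSym) :
    p ∈ (projProgram R xs t ys har F1 F2).preds ↔
      p = t ∨ p ∈ Program.preds (F1 ++ R :: F2) := by
  have h1 : p ∈ (R.project xs t ys har).1.toOpen.preds ↔
      p = t ∨ (∃ F ∈ R.betaBody xs, p ∈ F.preds) ∨ p ∈ R.headFormula.preds := by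
    rw [mem_preds_toOpen]
    simp only [mem_body_project_fst, exists_eq_or_imp, or_assoc]
    rfl
  have h2 : p ∈ (R.project xs t ys har).2.toOpen.preds ↔
      (∃ F ∈ R.alphaBody xs, p ∈ F.preds) ∨ p = t := by
    rw [mem_preds_toOpen]
    simp only [mem_body_project_snd]
    simp [headFormula_project_snd, projAtom, Formula.preds]
  have h3 : p ∈ R.toOpen.preds ↔ ((∃ F ∈ R.alphaBody xs, p ∈ F.preds) ∨
      (∃ F ∈ R.betaBody xs, p ∈ F.preds)) ∨ p ∈ R.headFormula.preds := by
    rw [mem_preds_toOpen]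
    simp only [mem_body_iff R xs, or_and_right, exists_or]
  have h (Pg : Program σ) : p ∉ Pg.preds ↔ ∀ Q ∈ Pg, p ∉ Q.toOpen.preds := by
    simp [Program.preds]
  rw [← not_iff_not, not_or, h, h, forall_mem_projProgram, forall_mem_program, h1, h2, h3]
  generalize (∀ Q ∈ F1 ++ F2, p ∉ Q.toOpen.preds) = X
  generalize (∃ F ∈ R.alphaBody xs, p ∈ F.preds) = A
  generalize (∃ F ∈ R.betaBody xs, p ∈ F.preds) = B
  generalize (p ∈ R.headFormula.preds) = C
  clear h h1 h2 h3
  tauto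

theorem mem_funs_projProgram (f : σ.FunSym) :
    f ∈ (projProgram R xs t ys har F1 F2).funs ↔ f ∈ Program.funs (F1 ++ R :: F2) := by
  have h1 : f ∈ (R.project xs t ys har).1.toOpen.funs ↔
      (∃ F ∈ R.betaBody xs, f ∈ F.funs) ∨ f ∈ R.headFormula.funs := by
    rw [mem_funs_toOpen]
    simp only [mem_body_project_fst, exists_eq_or_imp, or_assoc]
    simp [projAtom, Formula.funs, Term.funs, Rule.project, Rule.headFormula]
  have h2 : f ∈ (R.project xs t ys har).2.toOpen.funs ↔
      (∃ F ∈ R.alphaBody xs, f ∈ F.funs) := by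
    rw [mem_funs_toOpen]
    simp only [mem_body_project_snd]
    simp [headFormula_project_snd, projAtom, Formula.funs, Term.funs]
  have h3 : f ∈ R.toOpen.funs ↔ ((∃ F ∈ R.alphaBody xs, f ∈ F.funs) ∨
      (∃ F ∈ R.betaBody xs, f ∈ F.funs)) ∨ f ∈ R.headFormula.funs := by
    rw [mem_funs_toOpen]
    simp only [mem_body_iff R xs, or_and_right, exists_or]
  have h (Pg : Program σ) : f ∉ Pg.funs ↔ ∀ Q ∈ Pg, f ∉ Q.toOpen.funs := by
    simp [Program.funs]
  rw [← not_iff_not, h, h, forall_mem_projProgram, forall_mem_program, h1, h2, h3]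
  generalize (∀ Q ∈ F1 ++ F2, f ∉ Q.toOpen.funs) = X
  generalize (∃ F ∈ R.alphaBody xs, f ∈ F.funs) = A
  generalize (∃ F ∈ R.betaBody xs, f ∈ F.funs) = B
  generalize (f ∈ R.headFormula.funs) = C
  clear h h1 h2 h3
  tauto

variable {R xs t ys F1 F2}

theorem over_of_mem {Pg : Program σ} {Q : Rule σ} (hQ : Q ∈ Pg) : Q.toOpen.Over Pg.syms :=
  ⟨fun _ h => ⟨Q, hQ, h⟩, fun _ h => ⟨Q, hQ, h⟩⟩

theorem over_body {Pg : Program σ} {Q : Rule σ} (hQ : Q ∈ Pg) {F : Formula σ}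
    (hF : F ∈ Q.body) : F.Over Pg.syms :=
  ⟨fun p h => ⟨Q, hQ, (mem_preds_toOpen Q p).2 (.inl ⟨F, hF, h⟩)⟩,
    fun f h => ⟨Q, hQ, (mem_funs_toOpen Q f).2 (.inl ⟨F, hF, h⟩)⟩⟩

theorem over_alphaBody {F : Formula σ} (hF : F ∈ R.alphaBody xs) :
    F.Over (Program.syms (F1 ++ R :: F2)) :=
  over_body (by simp) ((mem_body_iff R xs F).2 (.inl hF))

theorem projRel_sat_restrict :
    projRel R xs t ys har (Sat (M.restrict (Program.syms (F1 ++ R :: F2)))) =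
      projRel R xs t ys har (Sat M) := by
  funext a
  refine propext (exists_congr fun v => and_congr Iff.rfl (forall₂_congr fun F hF => ?_))
  exact sat_restrict M (over_alphaBody hF) v

/-- In a stable model of the projected program, `t` is exactly `∃ x α(x, y)`. -/
theorem predI_eq_projRel_of_pStable {pk : Set σ.PredSym}
    (ht : t ∉ Program.preds (F1 ++ R :: F2))
    (hM : Program.PStable (pk ∪ {t}) (projProgram R xs t ys har F1 F2) M) :
    M.predI t = projRel R xs t ys har (Sat M) := by
  obtain ⟨hsat, hmin⟩ := hM
  rw [forall_mem_projProgram] at hsat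
  obtain ⟨hF, h1, h2⟩ := hsat
  have hle := (forall_sat_project_snd R xs t ys har M).1 h2
  by_contra hne
  let u : PredAssign σ M.U := PredAssign.set M.predI t (projRel R xs t ys har (Sat M))
  have hut : u t = projRel R xs t ys har (Sat M) := PredAssign.set_self _ _ _
  have hup : ∀ p, p ≠ t → u p = M.predI p := fun p hp => PredAssign.set_of_ne _ _ hp
  have htP : t ∈ pk ∪ {t} := Or.inr rfl
  have hstar : ∀ F : Formula σ, F.Over (Program.syms (F1 ++ R :: F2)) → ∀ v,
      (SatStar M u (pk ∪ {t}) v F ↔ Sat M v F) := fun F hF v =>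
    satStar_iff_sat M (fun p hp _ => hup p fun e => ht (e ▸ hF.1 hp)) v
  refine hmin ⟨u, ⟨fun p _ a hua => ?_, fun hcon => hne ?_⟩, ?_⟩
  · by_cases hpt : p = t
    · subst hpt; exact hle a (hut ▸ hua)
    · exact hup p hpt ▸ hua
  · funext a
    exact propext ⟨fun h => hut ▸ hcon t htP a h, hle a⟩
  · rw [forall_mem_projProgram]
    refine ⟨fun Q hQ v => (hstar _ (over_of_mem ?_) v).2 (hF Q hQ v), fun v => ?_, fun v => ?_⟩
    · simp only [List.mem_append, List.mem_cons] at hQ ⊢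
      tauto
    · rw [satStar_project_fst R xs t ys har M u htP]
      refine ⟨fun hu hβ => ?_, h1 v⟩
      have hRF : R ∈ F1 ++ R :: F2 := by simp
      have hhead : R.headFormula.Over (Program.syms (F1 ++ R :: F2)) :=
        ⟨fun p h => ⟨R, hRF, (mem_preds_toOpen R p).2 (.inr h)⟩,
          fun f h => ⟨R, hRF, (mem_funs_toOpen R f).2 (.inr h)⟩⟩
      rw [hstar _ hhead]
      refine (sat_project_fst R xs t ys har M v).1 (h1 v) (hle _ (hut ▸ hu)) fun F hF => ?_
      exact (hstar F (over_body hRF ((mem_body_iff R xs F).2 (.inr hF))) v).1 (hβ F hF)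
    · rw [satStar_project_snd R xs t ys har M u htP]
      refine ⟨fun hα => ?_, h2 v⟩
      rw [hut]
      exact ⟨v, rfl, fun F hF => (hstar F (over_alphaBody hF) v).1 (hα F hF)⟩

/-- When `t` is interpreted by `∃ x α(x, y)`, stability for the projected program is
stability of the reduct for the original program. -/
theorem pStable_projProgram_iff {pk : Set σ.PredSym}
    (hxh : xs ∩ R.headVars = ∅) (ht : t ∉ Program.preds (F1 ++ R :: F2))
    (hys : {v | v ∈ ys} = R.alphaVars xs)
    (M : SInterp σ (projProgram R xs t ys har F1 F2).syms)
    (hMt : M.predI t = projRel R xs t ys har (Sat M)) :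
    Program.PStable (pk ∪ {t}) (projProgram R xs t ys har F1 F2) M ↔
      Program.PStable pk (F1 ++ R :: F2) (M.restrict (Program.syms (F1 ++ R :: F2))) := by
  have htP : t ∈ pk ∪ {t} := Or.inr rfl
  have hRF : R ∈ F1 ++ R :: F2 := by simp
  have hmem : ∀ Q ∈ F1 ++ F2, Q ∈ F1 ++ R :: F2 := fun Q hQ => by
    simp only [List.mem_append, List.mem_cons] at hQ ⊢
    tauto
  have hsat : (∀ Q ∈ projProgram R xs t ys har F1 F2, ∀ v, Sat M v Q.toOpen) ↔
      ∀ Q ∈ F1 ++ R :: F2, ∀ v : ℕ → M.U,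
        Sat (M.restrict (Program.syms (F1 ++ R :: F2))) v Q.toOpen := by
    have hr : ∀ Q ∈ F1 ++ R :: F2, ((∀ v : ℕ → M.U,
        Sat (M.restrict (Program.syms (F1 ++ R :: F2))) v Q.toOpen) ↔
          ∀ v, Sat M v Q.toOpen) := fun Q hQ =>
      forall_congr' fun v => sat_restrict M (over_of_mem hQ) v
    rw [forall₂_congr hr, forall_mem_projProgram, forall_mem_program,
      and_iff_left ((forall_sat_project_snd R xs t ys har M).2 fun a h => hMt ▸ h)]
    refine and_congr Iff.rfl ?_
    simp only [sat_project_fst, sat_toOpen M _ R, hMt]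
    exact (forall_body_imp_head_iff R xs t ys har (fun F _ _ => sat_congr M F) hxh hys).symm
  refine and_congr_right_iff.2 ?_ |>.trans (and_congr hsat Iff.rfl)
  intro hG
  have hGM := (forall_mem_projProgram R xs t ys har F1 F2).1 hG
  have hFM := hsat.1 hG
  have hsR : ∀ v, Sat M v R.toOpen := fun v => (sat_restrict M (over_of_mem hRF) v).1 (hFM R hRF v)
  have hstar : ∀ (u u' : PredAssign σ M.U), (∀ p, p ≠ t → u p = u' p) →
      ∀ Q ∈ F1 ++ R :: F2, ∀ v : ℕ → M.U,
      (SatStar (M.restrict (Program.syms (F1 ++ R :: F2))) u pk v Q.toOpen ↔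
        SatStar M u' (pk ∪ {t}) v Q.toOpen) := fun u u' huu Q hQ v => by
    have hne : ∀ p ∈ Q.toOpen.preds, p ≠ t := fun p hp e => ht (e ▸ ⟨Q, hQ, hp⟩)
    exact satStar_restrict M (over_of_mem hQ) (fun p hp => by simp [hne p hp])
      (fun p hp => huu p (hne p hp)) v
  refine not_congr ⟨?_, ?_⟩
  · rintro ⟨u', ⟨hle, hnot⟩, hu'⟩
    rw [forall_mem_projProgram] at hu'
    obtain ⟨hs, hs1, hs2⟩ := hu'
    let u : PredAssign σ M.U := u'.set t fun _ => False
    have hut : u t = fun _ => False := PredAssign.set_self _ _ _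
    have hup : ∀ p, p ≠ t → u p = u' p := fun p hp => PredAssign.set_of_ne _ _ hp
    refine ⟨u, ⟨fun p hp a hua => ?_, fun hcon => hnot ?_⟩, ?_⟩
    · by_cases hpt : p = t
      · subst hpt
        rw [hut] at hua
        exact hua.elim
      · have hMp : M.predI p a := hle p (.inl hp) a (hup p hpt ▸ hua)
        refine ⟨?_, hMp⟩
        by_contra hpF
        refine (M.pred_default p (fun h => ?_) a) ▸ hMp
        exact ((mem_preds_projProgram R xs t ys har F1 F2 p).1 h).elim hpt hpF
    · have hge : ∀ p ∈ pk ∪ {t}, p ≠ t → ∀ a, M.predI p a → u' p a := by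
        intro p hp hpt a hMa
        have hpS : p ∈ (projProgram R xs t ys har F1 F2).preds := by
          by_contra h
          exact (M.pred_default p h a) ▸ hMa
        rw [← hup p hpt]
        exact hcon p (hp.resolve_right hpt) a
          ⟨((mem_preds_projProgram R xs t ys har F1 F2 p).1 hpS).resolve_left hpt, hMa⟩
      intro p hp a hMa
      by_cases hpt : p = t
      · subst hpt
        rw [hMt] at hMa
        obtain ⟨v, rfl, hv⟩ := hMa
        refine ((satStar_project_snd R xs p ys har M u' htP v).1 (hs2 v)).1 fun F hF => ?_
        refine (satStar_iff_sat M (fun q hq hqP => ?_) v).2 (hv F hF)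
        have hqt : q ≠ p := fun e =>
          ht (e ▸ (over_alphaBody (F1 := F1) (F2 := F2) hF).1 hq)
        funext a
        exact propext ⟨hle q hqP a, hge q hqP hqt a⟩
      · exact hge p hp hpt a hMa
    · intro Q hQ (v : ℕ → M.U)
      refine (hstar u u' hup Q hQ v).2 ?_
      revert Q
      rw [forall_mem_program]
      refine ⟨fun Q hQ => hs Q hQ v, ?_⟩
      rw [satStar_toOpen]
      refine ⟨fun hb => ?_, hsR v⟩
      refine ((satStar_project_fst R xs t ys har M u' htP v).1 (hs1 v)).1
        (((satStar_project_snd R xs t ys har M u' htP v).1 (hs2 v)).1 fun F hF => ?_)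
        fun F hF => ?_
      · exact hb F ((mem_body_iff R xs F).2 (.inl hF))
      · exact hb F ((mem_body_iff R xs F).2 (.inr hF))
  · rintro ⟨u, ⟨hle, hnot⟩, hu⟩
    change PredAssign σ M.U at u
    let T := projRel R xs t ys har (SatStar M u pk)
    let u' : PredAssign σ M.U := u.set t T
    have hut : u' t = T := PredAssign.set_self _ _ _
    have hup : ∀ p, p ≠ t → u p = u' p := fun p hp => (PredAssign.set_of_ne _ _ hp).symm
    have hlt : ∀ p ∈ pk, ∀ a, u p a → M.predI p a := fun p hp a h => (hle p hp a h).2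
    have hα : ∀ F ∈ R.alphaBody xs, ∀ v,
        (SatStar M u pk v F ↔ SatStar M u' (pk ∪ {t}) v F) := fun F hF v => by
      have hO := over_alphaBody (F1 := F1) (F2 := F2) hF
      have hne : ∀ p ∈ F.preds, p ≠ t := fun p hp e => ht (e ▸ hO.1 hp)
      rw [← satStar_restrict M hO (fun _ _ => Iff.rfl) (fun _ _ => rfl) v]
      exact satStar_restrict M hO (fun p hp => by simp [hne p hp])
        (fun p hp => hup p (hne p hp)) v
    have hT : T = projRel R xs t ys har (SatStar M u' (pk ∪ {t})) := by
      funext a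
      exact propext (exists_congr fun v => and_congr Iff.rfl
        (forall₂_congr fun F hF => hα F hF v))
    refine ⟨u', ⟨fun p hp a hua => ?_, fun hcon => hnot ?_⟩, ?_⟩
    · by_cases hpt : p = t
      · subst hpt
        rw [hut] at hua
        obtain ⟨v, rfl, hv⟩ := hua
        rw [hMt]
        exact ⟨v, rfl, fun F hF => (hv F hF).sat fun q _ hq => hlt q hq⟩
      · exact hlt p (hp.resolve_right hpt) a (hup p hpt ▸ hua)
    · rintro p hp a ⟨hpF, hMa⟩
      have hpt : p ≠ t := fun e => ht (e ▸ hpF)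
      rw [hup p hpt]
      exact hcon p (.inl hp) a hMa
    · have hu2 : ∀ Q ∈ F1 ++ R :: F2, ∀ v : ℕ → M.U, SatStar M u' (pk ∪ {t}) v Q.toOpen :=
        fun Q hQ v => (hstar u u' hup Q hQ v).1 (hu Q hQ v)
      rw [forall_mem_projProgram]
      refine ⟨fun Q hQ => hu2 Q (hmem Q hQ), fun v => ?_, fun v => ?_⟩
      · refine (satStar_project_fst R xs t ys har M u' htP v).2 ⟨?_, hGM.2.1 v⟩
        rw [hut, hT]
        exact (forall_body_imp_head_iff R xs t ys har
          (fun F _ _ => satStar_congr M u' (pk ∪ {t}) F) hxh hys).1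
          (fun w => ((satStar_toOpen M u' _ w R).1 (hu2 R hRF w)).1) v
      · refine (satStar_project_snd R xs t ys har M u' htP v).2 ⟨fun h => ?_, hGM.2.2 v⟩
        rw [hut, hT]
        exact ⟨v, rfl, h⟩

end Projection

/-- **Theorem 5 (projection for def-modules).** Let `SM_{p₁,…,p_k}[F]` be a
def-module, `R` a rule in `F` (so `F = F1 ++ R :: F2`), and `xs` a nonempty tuple of
variables occurring in the body of `R` but not in its head. If `G` is obtained from
`F` by replacing `R` with the result of projecting `xs` out of `R` using a predicate
symbol `t` not in the signature of `F`, then `SM_{p₁,…,p_k,t}[G]` is a conservative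
extension of `SM_{p₁,…,p_k}[F]`. -/
theorem projection_defmodule {σ : Signature} (pk : Set σ.PredSym)
    (F1 F2 : Program σ) (R : Rule σ)
    (xs : Set ℕ) (hxne : xs.Nonempty) (hxb : xs ⊆ Rule.bodyVars R)
    (hxh : xs ∩ Rule.headVars R = ∅)
    (t : σ.PredSym) (ht : t ∉ Program.preds (F1 ++ R :: F2))
    (ys : List ℕ) (hnd : ys.Nodup) (hys : {v | v ∈ ys} = Rule.alphaVars R xs)
    (har : σ.predArity t = ys.length) :
    ConsExt
      {M : SInterp σ (Program.syms
          (F1 ++ [(Rule.project R xs t ys har).1, (Rule.project R xs t ys har).2] ++ F2)) |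
        Program.PStable (pk ∪ {t})
          (F1 ++ [(Rule.project R xs t ys har).1, (Rule.project R xs t ys har).2] ++ F2) M}
      {M : SInterp σ (Program.syms (F1 ++ R :: F2)) |
        Program.PStable pk (F1 ++ R :: F2) M} := by
  have hpr := mem_preds_projProgram R xs t ys har F1 F2
  have hfu := mem_funs_projProgram R xs t ys har F1 F2
  have htG : t ∈ (projProgram R xs t ys har F1 F2).syms.preds := (hpr t).2 (.inl rfl)
  have hp : (Program.syms (F1 ++ R :: F2)).preds ⊆
    (projProgram R xs t ys har F1 F2).syms.preds := fun p h => (hpr p).2 (.inr h)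
  have hf : (Program.syms (F1 ++ R :: F2)).funs ⊆
    (projProgram R xs t ys har F1 F2).syms.funs := fun f h => (hfu f).2 h
  constructor
  · intro M hM
    exact (pStable_projProgram_iff har hxh ht hys M
      (predI_eq_projRel_of_pStable har M ht hM)).1 hM
  · intro N hN
    let M := N.extend hf hp t htG (projRel R xs t ys har (Sat N))
    have hMN : M.restrict (Program.syms (F1 ++ R :: F2)) = N :=
      N.extend_restrict hf hp t htG ht _
    have hMt : M.predI t = projRel R xs t ys har (Sat M) := by
      rw [← projRel_sat_restrict har M (F1 := F1) (F2 := F2)]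
      refine (PredAssign.set_self N.predI t _).trans ?_
      funext a
      refine propext (exists_congr fun v => and_congr Iff.rfl (forall₂_congr fun F hF => ?_))
      exact (sat_of_eq hMN rfl v F).symm
    refine ⟨M, ⟨(pStable_projProgram_iff har hxh ht hys M hMt).2 (hMN.symm ▸ hN), hMN⟩, ?_⟩
    rintro M' ⟨hM', rfl⟩
    refine (M'.restrict_extend hf hp t htG (fun f h => (hfu f).1 h) (fun p h => (hpr p).1 h)
      _ ?_).symm
    rw [predI_eq_projRel_of_pStable har M' ht hM']
    exact (projRel_sat_restrict har M').symm

end ASP
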